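/- arXiv:1809.05432 — 3 statements merged into one kernel-verified Lean document; each statement's English description precedes it below -/
import Mathlib

section
/- Let n be a composite integer with smallest prime factor ℓ, and suppose (q, n) ≠ (2, 9). Then the number C_q(n) of monic Carmichael polynomials of degree n in F_q[t] satisfies C_q(n) ≥ q^n / (2n)^ℓ. -/
open Polynomial

/-- `g` is a Carmichael polynomial: squarefree, not irreducible (composite), nonconstant,
and every monic irreducible factor has degree dividing `deg g`. -/
def IsCarmichaelPoly {F : Type} [Field F] (g : F[X]) : Prop :=
  Squarefree g ∧ ¬Irreducible g ∧ 0 < g.natDegree ∧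
    ∀ P : F[X], P.Monic → Irreducible P → P ∣ g → P.natDegree ∣ g.natDegree

theorem isCarmichaelPoly_prod {F : Type} [Field F] {T : Finset F[X]} {n : ℕ} (hn : 0 < n)
    (hmonic : ∀ P ∈ T, P.Monic) (hirr : ∀ P ∈ T, Irreducible P)
    (hdvd : ∀ P ∈ T, P.natDegree ∣ n) (hlt : ∀ P ∈ T, P.natDegree < n)
    (hsum : ∑ P ∈ T, P.natDegree = n) :
    (∏ P ∈ T, P).Monic ∧ IsCarmichaelPoly (∏ P ∈ T, P) ∧ (∏ P ∈ T, P).natDegree = n := by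
  have hdeg : (∏ P ∈ T, P).natDegree = n := by rw [natDegree_prod_of_monic _ _ hmonic, hsum]
  have key : ∀ P : F[X], Irreducible P → P ∣ ∏ Q ∈ T, Q → P.natDegree ∣ n ∧ P.natDegree < n := by
    intro P hP h
    obtain ⟨Q, hQ, hPQ⟩ := hP.prime.exists_mem_finset_dvd h
    have := natDegree_eq_of_degree_eq (degree_eq_degree_of_associated
      (hP.associated_of_dvd (hirr Q hQ) hPQ))
    rw [this]
    exact ⟨hdvd Q hQ, hlt Q hQ⟩
  refine ⟨monic_prod_of_monic _ _ hmonic, ⟨?_, fun h => ?_, hdeg ▸ hn, ?_⟩, hdeg⟩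
  · refine Finset.squarefree_prod_of_pairwise_isCoprime (fun P hP Q hQ hPQ => ?_)
      fun P hP => (hirr P hP).squarefree
    refine (hirr P hP).isRelPrime_iff_not_dvd.2 fun h => hPQ ?_
    exact eq_of_monic_of_associated (hmonic P hP) (hmonic Q hQ)
      ((hirr P hP).associated_of_dvd (hirr Q hQ) h)
  · exact (key _ h dvd_rfl).2.ne hdeg
  · intro P _ hP h
    rw [hdeg]
    exact (key P hP h).1

theorem subset_of_prod_monic_irreducible_eq {F : Type} [Field F] {T U : Finset F[X]}
    (hT : ∀ P ∈ T, P.Monic ∧ Irreducible P) (hU : ∀ P ∈ U, P.Monic ∧ Irreducible P)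
    (h : ∏ P ∈ T, P = ∏ P ∈ U, P) : T ⊆ U := by
  intro P hP
  have hd : P ∣ ∏ Q ∈ U, Q := h ▸ Finset.dvd_prod_of_mem _ hP
  obtain ⟨Q, hQ, hPQ⟩ := (hT P hP).2.prime.exists_mem_finset_dvd hd
  rwa [eq_of_monic_of_associated (hT P hP).1 (hU Q hQ).1
    ((hT P hP).2.associated_of_dvd (hU Q hQ).2 hPQ)]

theorem finite_natDegree_eq (F : Type) [Field F] [Finite F] (p : F[X] → Prop) (n : ℕ)
    (hp : ∀ g, p g → g.natDegree = n) : Finite {g : F[X] // p g} := by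
  refine Finite.of_injective
    (fun g : {g : F[X] // p g} => fun i : Fin (n + 1) => g.1.coeff i) fun f g h => Subtype.ext ?_
  refine (ext_iff_natDegree_le (hp _ f.2).le (hp _ g.2).le).2 fun i hi => ?_
  exact congrFun h ⟨i, Nat.lt_succ_of_le hi⟩

theorem sum_pow_Icc_add_two_le {q : ℕ} (hq : 2 ≤ q) (k : ℕ) :
    ∑ d ∈ Finset.Icc 1 k, q ^ d + 2 ≤ 2 * q ^ k := by
  induction k with
  | zero => simp
  | succ k ih =>
    rw [Finset.sum_Icc_succ_top (by omega), pow_succ]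
    nlinarith [Nat.mul_le_mul_left (q ^ k) hq]

theorem exists_finset_monic_irreducible (F : Type) [Field F] [Fintype F] {m : ℕ} (hm : 0 < m) :
    ∃ S : Finset F[X], (∀ P ∈ S, (P.Monic ∧ Irreducible P) ∧ P.natDegree = m) ∧
      Fintype.card F ^ m + 2 ≤ m * S.card + 2 * Fintype.card F ^ (m / 2) := by
  classical
  obtain ⟨p, hp⟩ := CharP.exists F
  have : Fact p.Prime := ⟨CharP.char_is_prime F p⟩
  have : NeZero m := ⟨hm.ne'⟩
  let K := FiniteField.Extension F p m
  let _ : Fintype K := Fintype.ofFinite K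
  have hint (a : K) : IsIntegral F a := Algebra.IsIntegral.isIntegral a
  have hq : 1 < Fintype.card F := Fintype.one_lt_card
  let A : Finset K := {a | (minpoly F a).natDegree = m}
  let B : Finset K := {a | ¬ (minpoly F a).natDegree = m}
  have hcard : A.card + B.card = Fintype.card F ^ m := by
    rw [Finset.card_filter_add_card_filter_not, Finset.card_univ, ← Nat.card_eq_fintype_card,
      FiniteField.natCard_extension, Nat.card_eq_fintype_card]
  have hA : A.card ≤ m * (A.image (minpoly F)).card := by
    refine Finset.card_le_mul_card_image _ _ fun P hP => ?_
    obtain ⟨a, ha, rfl⟩ := Finset.mem_image.1 hP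
    have hne : (minpoly F a).map (algebraMap F K) ≠ 0 :=
      map_ne_zero (minpoly.ne_zero (hint a))
    calc _ ≤ ((minpoly F a).map (algebraMap F K)).roots.toFinset.card := by
          refine Finset.card_le_card fun b hb => ?_
          rw [Multiset.mem_toFinset, mem_roots hne, IsRoot.def, eval_map_algebraMap,
            ← (Finset.mem_filter.1 hb).2]
          exact minpoly.aeval F b
      _ ≤ _ := Multiset.toFinset_card_le _
      _ ≤ _ := card_roots' _
      _ = m := by rw [natDegree_map]; exact (Finset.mem_filter.1 ha).2
  have hB : B.card ≤ ∑ d ∈ Finset.Icc 1 (m / 2), Fintype.card F ^ d := by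
    calc B.card ≤ ((Finset.Icc 1 (m / 2)).biUnion fun d =>
          (X ^ Fintype.card F ^ d - X : K[X]).roots.toFinset).card := by
          refine Finset.card_le_card fun a ha => ?_
          have hd : (minpoly F a).natDegree ∣ m := by
            have := minpoly.degree_dvd (hint a)
            rwa [FiniteField.finrank_extension] at this
          have hpos := minpoly.natDegree_pos (hint a)
          obtain ⟨c, hc⟩ := hd
          have hne := (Finset.mem_filter.1 ha).2
          have hc2 : 2 ≤ c := by
            rcases c with _ | _ | c
            · omega
            · omega
            · omega
          refine Finset.mem_biUnion.2 ⟨(minpoly F a).natDegree, Finset.mem_Icc.2 ⟨hpos, ?_⟩, ?_⟩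
          · rw [Nat.le_div_iff_mul_le two_pos]
            nlinarith
          · rw [Multiset.mem_toFinset,
              mem_roots (FiniteField.X_pow_card_pow_sub_X_ne_zero _ hpos.ne' hq)]
            have h := ((minpoly.irreducible (hint a)).natDegree_dvd_iff_dvd_X_pow_card_pow_sub_X).1
              dvd_rfl
            have h2 := aeval_eq_zero_of_dvd_aeval_eq_zero h (minpoly.aeval F a)
            simpa using h2
      _ ≤ ∑ d ∈ Finset.Icc 1 (m / 2), (X ^ Fintype.card F ^ d - X : K[X]).roots.toFinset.card :=
          Finset.card_biUnion_le
      _ ≤ _ := Finset.sum_le_sum fun d hd => by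
          refine (Multiset.toFinset_card_le _).trans ((card_roots' _).trans ?_)
          have := (Finset.mem_Icc.1 hd).1
          rw [FiniteField.X_pow_card_pow_sub_X_natDegree_eq _ (by omega) hq]
  refine ⟨A.image (minpoly F), fun P hP => ?_, ?_⟩
  · obtain ⟨a, ha, rfl⟩ := Finset.mem_image.1 hP
    exact ⟨⟨minpoly.monic (hint a), minpoly.irreducible (hint a)⟩, (Finset.mem_filter.1 ha).2⟩
  · have := sum_pow_Icc_add_two_le hq (m / 2)
    omega

theorem div_pow_le_choose {N r : ℕ} (h : r ≤ N) : ((N : ℝ) / r) ^ r ≤ (N.choose r : ℝ) := by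
  induction r generalizing N with
  | zero => simp
  | succ r ih =>
    obtain ⟨N, rfl⟩ : ∃ M, N = M + 1 := ⟨N - 1, by omega⟩
    have hr : r ≤ N := by omega
    have hchoose : ((N + 1).choose (r + 1) : ℝ) = (N + 1) / (r + 1) * N.choose r := by
      have h3 : ((N : ℝ) + 1) * N.choose r = (N + 1).choose (r + 1) * (r + 1) := by
        exact_mod_cast Nat.add_one_mul_choose_eq N r
      field_simp
      linarith
    rw [hchoose, pow_succ', Nat.cast_add_one, Nat.cast_add_one]
    refine mul_le_mul_of_nonneg_left (le_trans ?_ (ih hr)) (by positivity)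
    rcases Nat.eq_zero_or_pos r with rfl | hr0
    · simp
    have hr0' : (0 : ℝ) < r := by exact_mod_cast hr0
    have hr' : (r : ℝ) ≤ N := by exact_mod_cast hr
    refine pow_le_pow_left₀ (by positivity) ?_ _
    rw [div_le_div_iff₀ (by positivity) hr0']
    nlinarith

theorem two_mul_sq_lt_two_pow {m : ℕ} (hm : 6 ≤ m) : 2 * m * m < 2 ^ m + 2 * m := by
  induction m, hm using Nat.le_induction with
  | base => norm_num
  | succ m hm ih =>
    rw [pow_succ]
    nlinarith

theorem two_mul_sq_lt_three_pow {m : ℕ} (hm : 3 ≤ m) : 2 * m * m < 3 ^ m + 2 * m := by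
  induction m, hm using Nat.le_induction with
  | base => norm_num
  | succ m hm ih =>
    rw [pow_succ]
    nlinarith

theorem le_card_of_count {q m ℓ I : ℕ} (hq : 2 ≤ q) (hm : 2 ≤ m) (hℓ : 2 ≤ ℓ) (hℓm : ℓ ≤ m)
    (hodd : 2 < ℓ → ¬ 2 ∣ m) (h4 : ¬ (q = 2 ∧ m = 2)) (h9 : ¬ (q = 2 ∧ m = 3 ∧ ℓ = 3))
    (hcount : q ^ m + 2 ≤ m * I + 2 * q ^ (m / 2)) (hhalf : q ^ m ≤ 2 * m * I) : ℓ ≤ I := by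
  by_contra! hI
  have h2I : 2 * m * I ≤ 2 * m * (m - 1) := Nat.mul_le_mul_left _ (by omega)
  have hsub : 2 * m * (m - 1) + 2 * m = 2 * m * m := by
    obtain ⟨k, rfl⟩ : ∃ k, m = k + 1 := ⟨m - 1, by omega⟩
    simp; ring
  rcases Nat.lt_or_ge q 3 with hq3 | hq3
  · obtain rfl : q = 2 := by omega
    rcases Nat.lt_or_ge m 6 with hm6 | hm6
    · have : I < 5 := by omega
      interval_cases m <;> interval_cases I <;> simp at * <;> omega
    · have := two_mul_sq_lt_two_pow hm6
      omega
  · rcases Nat.lt_or_ge m 3 with hm3 | hm3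
    · obtain rfl : m = 2 := by omega
      have : I ≤ 1 := by omega
      nlinarith
    · have h1 := two_mul_sq_lt_three_pow hm3
      have h2 : 3 ^ m ≤ q ^ m := Nat.pow_le_pow_left hq3 m
      omega

theorem pow_le_two_mul_of_count {q m I : ℕ} (hq : 2 ≤ q)
    (hcount : q ^ m + 2 ≤ m * I + 2 * q ^ (m / 2)) : q ^ m ≤ 2 * m * I := by
  have h1 : q ^ (m / 2) * q ^ (m / 2) ≤ q ^ m := by
    rw [← pow_add]
    exact Nat.pow_le_pow_right (by omega) (by omega)
  zify at *
  nlinarith [sq_nonneg ((q : ℤ) ^ (m / 2) - 2)]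

theorem choose_le_card_carmichael {F : Type} [Field F] [Finite F] {m ℓ : ℕ} (hm : 0 < m)
    (hℓ : 2 ≤ ℓ) (S : Finset F[X])
    (hS : ∀ P ∈ S, (P.Monic ∧ Irreducible P) ∧ P.natDegree = m) :
    S.card.choose ℓ ≤
      Nat.card {g : F[X] // g.Monic ∧ IsCarmichaelPoly g ∧ g.natDegree = m * ℓ} := by
  have := finite_natDegree_eq F
    (fun g => g.Monic ∧ IsCarmichaelPoly g ∧ g.natDegree = m * ℓ) (m * ℓ) fun g hg => hg.2.2
  have hmem (T : Finset.powersetCard ℓ S) (P : F[X]) (hP : P ∈ T.1) :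
      (P.Monic ∧ Irreducible P) ∧ P.natDegree = m :=
    hS P ((Finset.mem_powersetCard.1 T.2).1 hP)
  rw [← Finset.card_powersetCard, ← Nat.card_eq_fintype_card.trans (Fintype.card_coe _)]
  refine Nat.card_le_card_of_injective (fun T : Finset.powersetCard ℓ S =>
    (⟨∏ P ∈ T.1, P, isCarmichaelPoly_prod (by positivity) (fun P hP => (hmem T P hP).1.1)
      (fun P hP => (hmem T P hP).1.2) (fun P hP => ?_) (fun P hP => ?_) ?_⟩ :
      {g : F[X] // g.Monic ∧ IsCarmichaelPoly g ∧ g.natDegree = m * ℓ})) fun T U h => ?_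
  · rw [(hmem T P hP).2]
    exact dvd_mul_right _ _
  · rw [(hmem T P hP).2]
    nlinarith
  · rw [Finset.sum_congr rfl fun P hP => (hmem T P hP).2, Finset.sum_const,
      (Finset.mem_powersetCard.1 T.2).2, smul_eq_mul, mul_comm]
  · have h := congrArg Subtype.val h
    exact Subtype.ext (Finset.Subset.antisymm
      (subset_of_prod_monic_irreducible_eq (fun P hP => (hmem T P hP).1) (fun P hP => (hmem U P hP).1) h)
      (subset_of_prod_monic_irreducible_eq (fun P hP => (hmem U P hP).1) (fun P hP => (hmem T P hP).1)
        h.symm))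

theorem card_carmichael_four_pos (F : Type) [Field F] [Fintype F] :
    0 < Nat.card {g : F[X] // g.Monic ∧ IsCarmichaelPoly g ∧ g.natDegree = 4} := by
  classical
  have := finite_natDegree_eq F
    (fun g => g.Monic ∧ IsCarmichaelPoly g ∧ g.natDegree = 4) 4 fun g hg => hg.2.2
  obtain ⟨S, hS, hcard⟩ := exists_finset_monic_irreducible F two_pos
  have hq : 2 ≤ Fintype.card F := Fintype.one_lt_card
  have hSpos : 0 < S.card := by
    have := pow_le_two_mul_of_count hq hcard
    have : 0 < Fintype.card F ^ 2 := by positivity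
    omega
  obtain ⟨P, hP⟩ := Finset.card_pos.1 hSpos
  obtain ⟨⟨hPm, hPi⟩, hPd⟩ := hS P hP
  have hXne : (X : F[X]) ≠ X - C 1 := fun h => by
    simpa using congrArg (eval 0) h
  have h1 : X ≠ P := by
    rintro rfl
    simp at hPd
  have h2 : X - C 1 ≠ P := by
    rintro rfl
    rw [natDegree_X_sub_C] at hPd
    omega
  refine Nat.card_pos_iff.2 ⟨⟨_, isCarmichaelPoly_prod (T := {X, X - C 1, P}) (by norm_num)
    ?_ ?_ ?_ ?_ ?_⟩, this⟩
  · simp only [Finset.forall_mem_insert, Finset.mem_singleton, forall_eq]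
    exact ⟨monic_X, monic_X_sub_C 1, hPm⟩
  · simp only [Finset.forall_mem_insert, Finset.mem_singleton, forall_eq]
    exact ⟨irreducible_X, irreducible_X_sub_C 1, hPi⟩
  · simp only [Finset.forall_mem_insert, Finset.mem_singleton, forall_eq, hPd, natDegree_X_sub_C,
      natDegree_X]
    norm_num
  · simp only [Finset.forall_mem_insert, Finset.mem_singleton, forall_eq, hPd, natDegree_X_sub_C,
      natDegree_X]
    norm_num
  · rw [Finset.sum_insert (by simp only [Finset.mem_insert, Finset.mem_singleton]; tauto),
      Finset.sum_pair h2, natDegree_X, natDegree_X_sub_C, hPd]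
    rfl

/-- Lower bound for the number of monic Carmichael polynomials of composite degree `n`:
if `ℓ` is the smallest prime factor of `n` and `(q, n) ≠ (2, 9)`, then
`C_q(n) ≥ q^n / (2n)^ℓ`. -/
theorem carmichael_poly_count_lower (F : Type) [Field F] [Fintype F] (n : ℕ)
    (hn : 1 < n) (hcomp : ¬n.Prime) (hne : ¬(Fintype.card F = 2 ∧ n = 9)) :
    (Fintype.card F : ℝ) ^ n / (2 * n) ^ n.minFac ≤
      (Nat.card {g : F[X] // g.Monic ∧ IsCarmichaelPoly g ∧ g.natDegree = n} : ℝ) := by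
  by_cases h4 : Fintype.card F = 2 ∧ n = 4
  · obtain ⟨hF, rfl⟩ := h4
    have h : (1 : ℝ) ≤
        (Nat.card {g : F[X] // g.Monic ∧ IsCarmichaelPoly g ∧ g.natDegree = 4} : ℝ) :=
      Nat.one_le_cast.2 (card_carmichael_four_pos F)
    refine le_trans ?_ h
    rw [hF, show Nat.minFac 4 = 2 by norm_num]
    norm_num
  have hq : 2 ≤ Fintype.card F := Fintype.one_lt_card
  have hℓ : 2 ≤ n.minFac := (Nat.minFac_prime hn.ne').two_le
  have hsq : n.minFac ^ 2 ≤ n := Nat.minFac_sq_le_self (by omega) hcomp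
  have hle (p : ℕ) (hp : 2 ≤ p) (hpn : p ∣ n) : n.minFac ≤ p := Nat.minFac_le_of_dvd hp hpn
  obtain ⟨m, hm⟩ := Nat.minFac_dvd n
  generalize n.minFac = ℓ at *
  obtain rfl : n = m * ℓ := by rw [hm, mul_comm]
  have hℓm : ℓ ≤ m := by nlinarith
  obtain ⟨S, hS, hcount⟩ := exists_finset_monic_irreducible F (m := m) (by omega)
  have hhalf := pow_le_two_mul_of_count hq hcount
  have hI : ℓ ≤ S.card := by
    refine le_card_of_count hq (hℓ.trans hℓm) hℓ hℓm (fun h2 hdvd => ?_) ?_ ?_ hcount hhalf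
    · have := hle 2 le_rfl (hdvd.mul_right ℓ)
      omega
    · rintro ⟨hF, rfl⟩
      obtain rfl : ℓ = 2 := by omega
      exact h4 ⟨hF, rfl⟩
    · rintro ⟨hF, rfl, rfl⟩
      exact hne ⟨hF, rfl⟩
  have hm0 : (0 : ℝ) < m := by exact_mod_cast (by omega : 0 < m)
  have hℓ0 : (0 : ℝ) < ℓ := by exact_mod_cast (by omega : 0 < ℓ)
  have hhalf' : (Fintype.card F : ℝ) ^ m ≤ 2 * m * S.card := by exact_mod_cast hhalf
  calc (Fintype.card F : ℝ) ^ (m * ℓ) / (2 * (m * ℓ : ℕ)) ^ ℓ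
      = ((Fintype.card F : ℝ) ^ m / (2 * (m * ℓ))) ^ ℓ := by
        rw [div_pow, pow_mul, Nat.cast_mul]
    _ ≤ ((S.card : ℝ) / ℓ) ^ ℓ := by
        refine pow_le_pow_left₀ (by positivity) ?_ _
        rw [div_le_div_iff₀ (by positivity) hℓ0]
        nlinarith
    _ ≤ (S.card.choose ℓ : ℝ) := div_pow_le_choose hI
    _ ≤ _ := Nat.cast_le.2 (choose_le_card_carmichael (by omega) hℓ S hS)
end

section
/- Let O_K be a Dedekind domain. A composite (non-prime, proper nonzero) ideal n of O_K with finite residue ring is a Carmichael ideal (i.e., α^{N(n)} ≡ α (mod n) for all α ∈ O_K, where N(n) = |O_K/n|) if and only if n is squarefree and for every prime ideal p dividing n, N(p) - 1 divides N(n) - 1. -/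
namespace Ideal

/-- An ideal modulo which every element is congruent to its own `k`-th power, `2 ≤ k`, is
squarefree. -/
theorem squarefree_of_forall_pow_sub_mem {O : Type*} [CommRing O] [IsDedekindDomain O]
    {n : Ideal O} (hbot : n ≠ ⊥) {k : ℕ} (hk : 2 ≤ k) (h : ∀ α : O, α ^ k - α ∈ n) :
    Squarefree n := by
  rintro x ⟨m, rfl⟩
  have hxm : x * m ≤ x * x * m := fun α hα ↦ by
    have hsq : α ^ 2 ∈ x * x * m := by
      have hle : (x * m) * (x * m) ≤ x * x * m :=
        Ideal.le_of_dvd ⟨m, by ring⟩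
      exact hle (by simpa [sq] using Ideal.mul_mem_mul hα hα)
    have hpow := Ideal.pow_mem_of_pow_mem _ hsq hk
    simpa using sub_mem hpow (h α)
  have hdvd : x * (x * m) ∣ 1 * (x * m) := by
    rw [one_mul, ← mul_assoc]
    exact Ideal.dvd_iff_le.2 hxm
  have hne : x * m ≠ 0 := fun h0 ↦ hbot (by rw [mul_assoc, h0, mul_zero]; rfl)
  exact isUnit_of_dvd_one ((mul_dvd_mul_iff_right hne).1 hdvd)

/-- A squarefree ideal of a Dedekind domain is radical. -/
theorem isRadical_of_squarefree {O : Type*} [CommRing O] [IsDedekindDomain O]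
    {n : Ideal O} (hn : Squarefree n) : n.IsRadical := by
  rintro x ⟨k, hx⟩
  rw [← Ideal.dvd_span_singleton, ← Ideal.span_singleton_pow] at hx
  exact Ideal.dvd_span_singleton.1 (hn.isRadical k _ hx)

/-- For a maximal ideal `p` with finite residue field, every element is congruent to its `k`-th
power modulo `p` if and only if `N(p) - 1 ∣ k - 1`. -/
theorem forall_pow_sub_mem_iff_of_isMaximal {O : Type*} [CommRing O] (p : Ideal O)
    [p.IsMaximal] [Finite (O ⧸ p)] {k : ℕ} (hk : k ≠ 0) :
    (∀ α : O, α ^ k - α ∈ p) ↔ Nat.card (O ⧸ p) - 1 ∣ k - 1 := by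
  let := Ideal.Quotient.field p
  have := Fintype.ofFinite (O ⧸ p)
  rw [Nat.card_eq_fintype_card, ← FiniteField.forall_pow_eq_one_iff]
  have hmem (α : O) : α ^ k - α ∈ p ↔ Ideal.Quotient.mk p α ^ k = Ideal.Quotient.mk p α := by
    rw [← map_pow, Ideal.Quotient.eq]
  simp_rw [hmem]
  rw [← Ideal.Quotient.mk_surjective.forall (p := fun a : O ⧸ p ↦ a ^ k = a)]
  obtain ⟨k, rfl⟩ := Nat.exists_eq_succ_of_ne_zero hk
  simp only [Nat.succ_eq_add_one, Nat.add_sub_cancel]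
  refine ⟨fun h u ↦ ?_, fun h a ↦ ?_⟩
  · have hu : u ^ (k + 1) = u := Units.ext (by simpa using h u)
    rwa [pow_succ, mul_eq_right] at hu
  · obtain rfl | ha := eq_or_ne a 0
    · simp
    · have hu := congrArg Units.val (h (Units.mk0 a ha))
      rw [Units.val_pow_eq_pow_val, Units.val_mk0, Units.val_one] at hu
      rw [pow_succ, hu, one_mul]

end Ideal


/-- Korselt's criterion for Dedekind domains: a composite ideal `n` (nonzero, proper, not
prime) of a Dedekind domain `O` with finite residue ring is a Carmichael ideal
(`α ^ N(n) ≡ α (mod n)` for all `α`, where `N(n) = |O/n|`) if and only if `n` is squarefree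
and `N(p) - 1 ∣ N(n) - 1` for every prime ideal `p ∣ n`. -/
theorem korselt_criterion_dedekind (O : Type) [CommRing O] [IsDedekindDomain O]
    (n : Ideal O) (hbot : n ≠ ⊥) (htop : n ≠ ⊤) (hprime : ¬n.IsPrime)
    (hfin : Finite (O ⧸ n)) :
    (∀ α : O, α ^ Nat.card (O ⧸ n) - α ∈ n) ↔
      Squarefree n ∧
        ∀ p : Ideal O, p.IsPrime → p ∣ n →
          Nat.card (O ⧸ p) - 1 ∣ Nat.card (O ⧸ n) - 1 := by
  have : Nontrivial (O ⧸ n) := Ideal.Quotient.nontrivial_iff.2 htop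
  have hcard : 1 < Nat.card (O ⧸ n) := Finite.one_lt_card
  have hp_iff (p : Ideal O) (hp : p.IsPrime) (hnp : n ≤ p) :
      (∀ α : O, α ^ Nat.card (O ⧸ n) - α ∈ p) ↔
        Nat.card (O ⧸ p) - 1 ∣ Nat.card (O ⧸ n) - 1 := by
    have : p.IsMaximal := hp.isMaximal fun h ↦ hbot (le_bot_iff.1 (h ▸ hnp))
    have : Finite (O ⧸ p) :=
      Finite.of_surjective (Ideal.Quotient.factor hnp) (Ideal.Quotient.factor_surjective hnp)
    exact p.forall_pow_sub_mem_iff_of_isMaximal (by lia)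
  refine ⟨fun h ↦ ⟨Ideal.squarefree_of_forall_pow_sub_mem hbot hcard h, fun p hp hpn ↦ ?_⟩, ?_⟩
  · have hnp := Ideal.le_of_dvd hpn
    exact (hp_iff p hp hnp).1 fun α ↦ hnp (h α)
  · rintro ⟨hsq, h⟩ α
    refine Ideal.isRadical_of_squarefree hsq ?_
    rw [Ideal.radical_eq_sInf, Submodule.mem_sInf]
    rintro p ⟨hnp, hp⟩
    exact (hp_iff p hp hnp).2 (h p hp (Ideal.dvd_iff_le.2 hnp)) α
end

section
/- Let g ∈ F_q[t] be a squarefree polynomial that is a Carmichael polynomial, and let K be a finite Galois extension of F_q(t) of degree d whose discriminant is coprime to g. Then g generates a Carmichael ideal in the integral closure O_K of F_q[t] in K. -/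
open Polynomial

theorem Ideal.natCard_quotient_map_of_free {A B : Type*} [CommRing A] [Nontrivial A] [CommRing B]
    [Algebra A B] [Module.Free A B] [Module.Finite A B] (I : Ideal A) :
    Nat.card (B ⧸ I.map (algebraMap A B)) = Nat.card (A ⧸ I) ^ Module.finrank A B := by
  let b := Module.Free.chooseBasis A B
  rw [Nat.card_congr ((Algebra.TensorProduct.quotIdealMapEquivTensorQuot B I).toEquiv.trans
    ((TensorProduct.comm A B (A ⧸ I)).toEquiv.trans
      (Algebra.TensorProduct.basis (A ⧸ I) b).equivFun.toEquiv)),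
    Nat.card_fun, Module.finrank_eq_nat_card_basis b]

theorem Polynomial.natCard_quotient_span_singleton {F : Type*} [Field F] {f : F[X]} (hf : f ≠ 0) :
    Nat.card (F[X] ⧸ Ideal.span {f}) = Nat.card F ^ f.natDegree := by
  have : Module.Finite F (F[X] ⧸ Ideal.span {f}) := (AdjoinRoot.powerBasis hf).finite
  rw [Module.natCard_eq_pow_finrank (K := F), finrank_quotient_span_eq_natDegree]

theorem Ideal.inertiaDeg_dvd_natCard_of_isGaloisGroup {A B : Type*} [CommRing A] [IsDomain A]
    [CommRing B] [IsDomain B] [Algebra A B] [Module.Finite A B] [Module.Flat A B]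
    (G : Type*) [Group G] [Finite G] [MulSemiringAction G B] [IsGaloisGroup G A B]
    (P : Ideal B) [P.IsPrime] : P.inertiaDeg A ∣ Nat.card G := by
  rw [← ncard_primesOver_mul_ramificationIdxIn_mul_inertiaDegIn (P.under A) B G,
    ← inertiaDegIn_eq_inertiaDeg (P.under A) P G]
  exact (dvd_mul_left _ _).mul_left _

theorem Ideal.natCard_quotient_eq_pow_inertiaDeg {A B : Type*} [CommRing A] [CommRing B]
    [Algebra A B] [Module.Finite A B] (p : Ideal A) (P : Ideal B) [P.LiesOver p] [p.IsMaximal]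
    [P.IsMaximal] : Nat.card (B ⧸ P) = Nat.card (A ⧸ p) ^ P.inertiaDeg A := by
  let : Field (A ⧸ p) := Ideal.Quotient.field p
  rw [inertiaDeg_eq_of_isMaximal p P, Module.natCard_eq_pow_finrank (K := A ⧸ p)]

theorem Ideal.Quotient.pow_natCard_pow {B : Type*} [CommRing B] (P : Ideal B) [P.IsMaximal]
    [Finite (B ⧸ P)] (n : ℕ) (x : B) : x ^ Nat.card (B ⧸ P) ^ n - x ∈ P := by
  let : Field (B ⧸ P) := Ideal.Quotient.field P
  let := Fintype.ofFinite (B ⧸ P)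
  rw [← Ideal.Quotient.eq, map_pow, Nat.card_eq_fintype_card, FiniteField.pow_card_pow]

theorem Ideal.isRadical_of_squarefree_s19 {B : Type*} [CommRing B] [IsDedekindDomain B] {I : Ideal B}
    (hI : Squarefree I) : I.IsRadical := by
  rintro x ⟨n, hx⟩
  rw [← Ideal.dvd_span_singleton] at hx ⊢
  rw [← Ideal.span_singleton_pow] at hx
  exact hI.isRadical n _ hx

/-- A Carmichael polynomial `g ∈ F_q[t]` remains Carmichael in every finite Galois extension
`K` of `F_q(t)` whose discriminant is coprime to `g` (equivalently, every prime factor of `g`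
is unramified in `K`, i.e. `g O_K` is squarefree): the ideal generated by `g` in the integral
closure `O_K` of `F_q[t]` in `K` is a Carmichael ideal. -/
theorem carmichael_poly_galois_extension (F : Type) [Field F] [Fintype F]
    (K O : Type) [Field K] [CommRing O]
    [Algebra (RatFunc F) K] [FiniteDimensional (RatFunc F) K] [IsGalois (RatFunc F) K]
    [Algebra F[X] O] [Algebra O K] [Algebra F[X] K]
    [IsScalarTower F[X] O K] [IsScalarTower F[X] (RatFunc F) K]
    [IsIntegralClosure O F[X] K]
    (g : F[X]) (hg : IsCarmichaelPoly g)
    (hunram : Squarefree (Ideal.map (algebraMap F[X] O) (Ideal.span {g}))) :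
    (¬(Ideal.map (algebraMap F[X] O) (Ideal.span {g})).IsPrime ∧
      Ideal.map (algebraMap F[X] O) (Ideal.span {g}) ≠ ⊥ ∧
      Ideal.map (algebraMap F[X] O) (Ideal.span {g}) ≠ ⊤) ∧
    ∀ α : O, α ^ Nat.card (O ⧸ Ideal.map (algebraMap F[X] O) (Ideal.span {g})) - α ∈
      Ideal.map (algebraMap F[X] O) (Ideal.span {g}) := by
  have : IsDomain O := (IsIntegralClosure.algebraMap_injective O F[X] K).isDomain (algebraMap O K)
  have := IsIntegralClosure.isDedekindDomain F[X] (RatFunc F) K O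
  have : Module.IsTorsionFree F[X] K := .trans_faithfulSMul F[X] (RatFunc F) K
  have : Module.Finite F[X] O := IsIntegralClosure.finite F[X] (RatFunc F) K O
  have : Module.Free F[X] O := IsIntegralClosure.module_free F[X] (RatFunc F) K O
  have : IsFractionRing O K :=
    IsIntegralClosure.isFractionRing_of_finite_extension F[X] (RatFunc F) K O
  let : MulSemiringAction Gal(K/RatFunc F) O :=
    IsIntegralClosure.MulSemiringAction F[X] (RatFunc F) K O
  have : IsGaloisGroup Gal(K/RatFunc F) F[X] O := .of_isFractionRing _ _ _ (RatFunc F) K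
  have hrank : Module.finrank F[X] O = Nat.card Gal(K/RatFunc F) := by
    rw [IsIntegralClosure.rank F[X] (RatFunc F) K O, IsGaloisGroup.card_eq_finrank _ (RatFunc F) K]
  obtain ⟨hsq, hirr, hdeg, hdvd⟩ := hg
  have hg0 : g ≠ 0 := hsq.ne_zero
  have hcomap := Ideal.comap_map_eq_self_of_faithfullyFlat (B := O) (Ideal.span {g})
  have hcard := Ideal.natCard_quotient_map_of_free (B := O) (Ideal.span {g})
  rw [Polynomial.natCard_quotient_span_singleton hg0, ← pow_mul, hrank] at hcard
  set I := Ideal.map (algebraMap F[X] O) (Ideal.span {g})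
  have hmem : algebraMap F[X] O g ∈ I :=
    Ideal.mem_map_of_mem _ (Ideal.mem_span_singleton_self g)
  refine ⟨⟨fun hprime ↦ hirr ?_, hunram.ne_zero, fun htop ↦ ?_⟩, fun α ↦ ?_⟩
  · have := hprime.comap (algebraMap F[X] O)
    rw [hcomap, Ideal.span_singleton_prime hg0] at this
    exact this.irreducible
  · rw [htop, Ideal.comap_top, eq_comm, Ideal.span_singleton_eq_top] at hcomap
    exact hdeg.ne' (natDegree_eq_zero_of_isUnit hcomap)
  suffices α ^ Nat.card (O ⧸ I) - α ∈ I.radical by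
    rwa [(Ideal.isRadical_of_squarefree_s19 hunram).radical] at this
  rw [hcard, Ideal.radical_eq_sInf, Ideal.mem_sInf]
  rintro P ⟨hIP, hP⟩
  have hgP : g ∈ P.under F[X] := hIP hmem
  have hp0 : P.under F[X] ≠ ⊥ := fun h ↦ hg0 (by simpa [h] using hgP)
  have hpmax : (P.under F[X]).IsMaximal := Ideal.IsPrime.isMaximal inferInstance hp0
  have hPmax : P.IsMaximal := Ideal.isMaximal_of_isIntegral_of_isMaximal_comap P hpmax
  obtain ⟨π, hπm, hπ⟩ : ∃ π : F[X], π.Monic ∧ P.under F[X] = Ideal.span {π} := by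
    obtain ⟨a, ha⟩ := IsPrincipalIdealRing.principal (P.under F[X])
    classical
    refine ⟨normalize a, Polynomial.monic_normalize ?_, ?_⟩
    · rintro rfl
      exact hp0 (by simpa using ha)
    · rw [ha]
      exact (Ideal.span_singleton_eq_span_singleton.2 (normalize_associated a)).symm
  have hπirr : Irreducible π := by
    rw [hπ] at hpmax
    exact ((Ideal.span_singleton_prime hπm.ne_zero).1 hpmax.isPrime).irreducible
  have hπg : π ∣ g := by rwa [hπ, Ideal.mem_span_singleton] at hgP
  have hcardP := Ideal.natCard_quotient_eq_pow_inertiaDeg (P.under F[X]) P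
  rw [hπ, Polynomial.natCard_quotient_span_singleton hπm.ne_zero, ← pow_mul] at hcardP
  have : Finite (O ⧸ P) := Nat.finite_of_card_ne_zero (by
    rw [hcardP]
    exact pow_ne_zero _ Nat.card_pos.ne')
  obtain ⟨n, hn⟩ := mul_dvd_mul (hdvd π hπm hπirr hπg)
    (Ideal.inertiaDeg_dvd_natCard_of_isGaloisGroup (A := F[X]) Gal(K/RatFunc F) P)
  rw [hn, pow_mul, ← hcardP]
  exact Ideal.Quotient.pow_natCard_pow P n α
end
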